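/- For every positive integer n, the number r_2(n) of representations of n as an ordered sum of two squares of integers satisfies r_2(n) = 4(d_1(n) - d_3(n)), where d_1(n) and d_3(n) count divisors of n congruent to 1 and 3 modulo 4, respectively. -/

import Mathlib

open Finset

/-- `r₂(n)`: the number of representations of `n` as an ordered sum of two squares. -/
noncomputable def r2 (n : ℕ) : ℕ :=
  Set.ncard {p : ℤ × ℤ | p.1 ^ 2 + p.2 ^ 2 = (n : ℤ)}

/-- `d_j(n)`: the number of divisors of `n` congruent to `j` mod 4. -/
def dMod4 (j n : ℕ) : ℕ := (n.divisors.filter (fun d => d % 4 = j)).card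

/-- Gaussian integers of norm `n`. -/
def gS (n : ℕ) : Set GaussianInt := {z | z.norm = (n : ℤ)}

lemma gnorm (z : GaussianInt) : z.norm = z.re ^ 2 + z.im ^ 2 := by
  rw [Zsqrtd.norm_def]; ring

lemma r2_eq_gS (n : ℕ) : r2 n = (gS n).ncard := by
  unfold r2
  refine Set.ncard_congr (fun p _ => (⟨p.1, p.2⟩ : GaussianInt)) ?_ ?_ ?_
  · rintro ⟨a, b⟩ h
    simpa [gS, gnorm] using h
  · rintro ⟨a, b⟩ ⟨c, d⟩ _ _ h
    simpa [Zsqrtd.ext_iff] using h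
  · intro z hz
    exact ⟨(z.re, z.im), by simpa [gS, gnorm] using hz, rfl⟩

lemma gS_finite (n : ℕ) : (gS n).Finite := by
  have hf : (Set.Icc (-(n : ℤ)) n ×ˢ Set.Icc (-(n : ℤ)) n).Finite :=
    (Set.finite_Icc _ _).prod (Set.finite_Icc _ _)
  refine (hf.image (fun p : ℤ × ℤ => (⟨p.1, p.2⟩ : GaussianInt))).subset ?_
  intro z hz
  have h : z.re ^ 2 + z.im ^ 2 = (n : ℤ) := by rw [← gnorm]; exact hz
  have h1 : |z.re| ≤ n := by
    have h0 : |z.re| ≤ z.re ^ 2 := by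
      rw [Int.abs_eq_natAbs]; exact Int.natAbs_le_self_sq z.re
    nlinarith [sq_nonneg z.im]
  have h2 : |z.im| ≤ n := by
    have h0 : |z.im| ≤ z.im ^ 2 := by
      rw [Int.abs_eq_natAbs]; exact Int.natAbs_le_self_sq z.im
    nlinarith [sq_nonneg z.re]
  exact ⟨(z.re, z.im), ⟨abs_le.mp h1, abs_le.mp h2⟩, rfl⟩

lemma gS_mul_ncard (c : GaussianInt) (hc : c ≠ 0) (n : ℕ) :
    ((fun z => c * z) '' gS n).ncard = (gS n).ncard :=
  Set.ncard_image_of_injective _ (mul_right_injective₀ hc)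

/-- multiples of `c` in `gS (q * m)` when `c` has norm `q`. -/
lemma gS_image (c : GaussianInt) (q m : ℕ) (hq : 0 < q) (hc : c.norm = q) :
    (fun z => c * z) '' gS m = {z | z ∈ gS (q * m) ∧ c ∣ z} := by
  ext z
  constructor
  · rintro ⟨w, hw, rfl⟩
    have hw' : w.norm = (m : ℤ) := hw
    refine ⟨?_, dvd_mul_right _ _⟩
    simp [gS, Zsqrtd.norm_mul, hc, hw']
  · rintro ⟨hz, w, rfl⟩
    refine ⟨w, ?_, rfl⟩
    have hz' : (c * w).norm = ((q * m : ℕ) : ℤ) := hz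
    rw [Zsqrtd.norm_mul, hc] at hz'
    push_cast at hz'
    exact mul_left_cancel₀ (by exact_mod_cast hq.ne') hz'

lemma ne_zero_of_gnorm (c : GaussianInt) (q : ℕ) (hq : 0 < q) (hc : c.norm = q) : c ≠ 0 := by
  rintro rfl
  simp at hc
  omega

lemma gS_two (m : ℕ) : (gS (2 * m)).ncard = (gS m).ncard := by
  have hc : (⟨1, 1⟩ : GaussianInt).norm = (2 : ℕ) := by rw [gnorm]; norm_num
  rw [← gS_mul_ncard ⟨1, 1⟩ (ne_zero_of_gnorm _ 2 (by norm_num) hc) m,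
    gS_image _ 2 m (by norm_num) hc]
  congr 1
  ext z
  refine ⟨fun hz => ⟨hz, ?_⟩, fun h => h.1⟩
  have h : z.re ^ 2 + z.im ^ 2 = 2 * (m : ℤ) := by
    rw [← gnorm]; simpa [gS] using hz
  have he : Even (z.re + z.im) := by
    have : Even (z.re ^ 2 + z.im ^ 2) := by rw [h]; exact even_two_mul _
    simpa [Int.even_add, Int.even_pow] using this
  obtain ⟨k, hk⟩ := he
  refine ⟨⟨k, k - z.re⟩, ?_⟩
  rw [Zsqrtd.ext_iff]
  simp
  omega

lemma nat_dvd_of_dvd_star (p : ℕ) (z : GaussianInt) (h : (p : GaussianInt) ∣ star z) :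
    (p : GaussianInt) ∣ z := by
  obtain ⟨w, hw⟩ := h
  refine ⟨star w, ?_⟩
  rw [← star_star z, hw]
  simp [star_mul, mul_comm]

lemma gS_dvd_mul_star (p m : ℕ) (z : GaussianInt) (hz : z ∈ gS (p * m)) :
    (p : GaussianInt) ∣ z * star z := by
  have h : z.norm = ((p * m : ℕ) : ℤ) := hz
  rw [← Zsqrtd.norm_eq_mul_conj, h]
  push_cast
  exact dvd_mul_right _ _

lemma gS_three_dvd (p m : ℕ) (hp : p.Prime) (h3 : p % 4 = 3) (z : GaussianInt)
    (hz : z ∈ gS (p * m)) : (p : GaussianInt) ∣ z := by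
  have := Fact.mk hp
  have hP := GaussianInt.prime_of_nat_prime_of_mod_four_eq_three p h3
  rcases hP.dvd_or_dvd (gS_dvd_mul_star p m z hz) with h | h
  · exact h
  · exact nat_dvd_of_dvd_star p z h

lemma gnorm_natCast (p : ℕ) : ((p : GaussianInt)).norm = ((p * p : ℕ) : ℤ) := by
  rw [Zsqrtd.norm_natCast]; push_cast; ring

lemma gS_three_ndvd (p m : ℕ) (hp : p.Prime) (h3 : p % 4 = 3) (hm : ¬ p ∣ m) :
    (gS (p * m)).ncard = 0 := by
  rw [Set.ncard_eq_zero (gS_finite _), Set.eq_empty_iff_forall_notMem]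
  intro z hz
  obtain ⟨w, rfl⟩ := gS_three_dvd p m hp h3 z hz
  have h : ((p : GaussianInt) * w).norm = ((p * m : ℕ) : ℤ) := hz
  rw [Zsqrtd.norm_mul, gnorm_natCast] at h
  push_cast at h
  apply hm
  have h' : (p : ℤ) * w.norm = m :=
    mul_left_cancel₀ (a := (p : ℤ)) (by exact_mod_cast hp.ne_zero) (by linarith)
  exact_mod_cast Dvd.intro _ h'

lemma gS_three_mul (p k : ℕ) (hp : p.Prime) (h3 : p % 4 = 3) :
    (gS (p * (p * k))).ncard = (gS k).ncard := by
  have hpp : 0 < p * p := Nat.mul_pos hp.pos hp.pos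
  rw [← gS_mul_ncard p (ne_zero_of_gnorm _ _ hpp (gnorm_natCast p)) k,
    gS_image _ _ k hpp (gnorm_natCast p)]
  congr 1
  ext z
  rw [mul_assoc]
  exact ⟨fun hz => ⟨hz, gS_three_dvd p _ hp h3 z hz⟩, fun h => h.1⟩

lemma gprime_of_norm (c : GaussianInt) (p : ℕ) (hp : p.Prime) (hc : c.norm = p) : Prime c := by
  rw [← irreducible_iff_prime]
  constructor
  · intro hu
    have := Zsqrtd.norm_eq_one_iff.mpr hu
    rw [hc] at this
    simp at this
    exact hp.one_lt.ne' this
  · intro a b hab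
    rw [hab, Zsqrtd.norm_mul] at hc
    have h := congrArg Int.natAbs hc
    rw [Int.natAbs_mul, Int.natAbs_natCast] at h
    rcases (Nat.prime_mul_iff.mp (h ▸ hp)) with h' | h'
    · exact Or.inr (Zsqrtd.norm_eq_one_iff.mp h'.2)
    · exact Or.inl (Zsqrtd.norm_eq_one_iff.mp h'.2)

lemma gS_one_split (p : ℕ) (hp : p.Prime) (h1 : p % 4 = 1) :
    ∃ c : GaussianInt, c.norm = p ∧ (star c).norm = p ∧ c * star c = p ∧ ¬ star c ∣ c := by
  have := Fact.mk hp
  obtain ⟨a, b, hab⟩ := Nat.Prime.sq_add_sq (p := p) (by omega)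
  have hc : (⟨a, b⟩ : GaussianInt).norm = p := by 
    rw [gnorm]
    change (a : ℤ) ^ 2 + (b : ℤ) ^ 2 = p
    exact_mod_cast hab
  have hc' : (star (⟨a, b⟩ : GaussianInt)).norm = p := by rw [Zsqrtd.norm_conj, hc]
  refine ⟨⟨a, b⟩, hc, hc', ?_, ?_⟩
  · rw [← Zsqrtd.norm_eq_mul_conj, hc]; simp
  · intro hd
    have h2 : star (⟨a, b⟩ : GaussianInt) ∣ ((2 * a : ℕ) : GaussianInt) := by
      have : ((2 * a : ℕ) : GaussianInt) = ⟨a, b⟩ + star ⟨a, b⟩ := by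
        rw [Zsqrtd.ext_iff]; simp; ring
      rw [this]
      exact dvd_add hd dvd_rfl
    obtain ⟨w, hw⟩ := h2
    have hn := congrArg Zsqrtd.norm hw
    rw [Zsqrtd.norm_mul, hc', gnorm_natCast] at hn
    have hdv : p ∣ 2 * a * (2 * a) := by exact_mod_cast Dvd.intro _ hn.symm
    have hpa : p ∣ a := by
      have h2a : p ∣ 2 * a := by rcases hp.dvd_mul.mp hdv with h | h <;> exact h
      rcases hp.dvd_mul.mp h2a with h | h
      · have := Nat.le_of_dvd (by norm_num) h
        have := hp.two_le
        have : p = 2 := by omega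
        omega
      · exact h
    have hpb : p ∣ b := by
      apply hp.dvd_of_dvd_pow (n := 2)
      rw [← Nat.dvd_add_right (hpa.pow two_ne_zero : p ∣ a ^ 2)]
      rw [hab]
    obtain ⟨x, rfl⟩ := hpa
    obtain ⟨y, rfl⟩ := hpb
    have : p * (p * (x ^ 2 + y ^ 2)) = p * 1 := by rw [mul_one]; nlinarith
    have := Nat.eq_of_mul_eq_mul_left hp.pos this
    exact hp.one_lt.ne' (Nat.dvd_one.mp (Dvd.intro _ this))

lemma gS_one_aux (p m : ℕ) (hp : p.Prime) (h1 : p % 4 = 1) :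
    (gS (p * m)).ncard + {z | z ∈ gS (p * m) ∧ (p : GaussianInt) ∣ z}.ncard
      = 2 * (gS m).ncard := by
  obtain ⟨c, hc, hc', hcc, hnd⟩ := gS_one_split p hp h1
  have hP := gprime_of_norm c p hp hc
  have hP' := gprime_of_norm (star c) p hp hc'
  have hu : (gS (p * m)) =
      {z | z ∈ gS (p * m) ∧ c ∣ z} ∪ {z | z ∈ gS (p * m) ∧ star c ∣ z} := by
    ext z
    refine ⟨fun hz => ?_, fun h => h.elim (fun h => h.1) (fun h => h.1)⟩
    have hd : c ∣ z * star z := (Dvd.intro _ hcc).trans (gS_dvd_mul_star p m z hz)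
    rcases hP.dvd_or_dvd hd with h | h
    · exact Or.inl ⟨hz, h⟩
    · obtain ⟨w, hw⟩ := h
      refine Or.inr ⟨hz, star w, ?_⟩
      rw [← star_star z, hw, star_mul, mul_comm]
  have hi : {z | z ∈ gS (p * m) ∧ (p : GaussianInt) ∣ z} =
      {z | z ∈ gS (p * m) ∧ c ∣ z} ∩ {z | z ∈ gS (p * m) ∧ star c ∣ z} := by
    ext z
    constructor
    · rintro ⟨hz, hd⟩
      exact ⟨⟨hz, (Dvd.intro _ hcc).trans hd⟩, ⟨hz, (Dvd.intro_left _ hcc).trans hd⟩⟩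
    · rintro ⟨⟨hz, w, rfl⟩, ⟨_, hd⟩⟩
      refine ⟨hz, ?_⟩
      rcases hP'.dvd_or_dvd hd with h | h
      · exact absurd h hnd
      · rw [← hcc]; exact mul_dvd_mul_left _ h
  have hA : {z | z ∈ gS (p * m) ∧ c ∣ z}.ncard = (gS m).ncard := by
    rw [← gS_image c p m hp.pos hc, gS_mul_ncard _ hP.ne_zero]
  have hB : {z | z ∈ gS (p * m) ∧ star c ∣ z}.ncard = (gS m).ncard := by
    rw [← gS_image (star c) p m hp.pos hc', gS_mul_ncard _ hP'.ne_zero]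
  have key := Set.ncard_union_add_ncard_inter {z | z ∈ gS (p * m) ∧ c ∣ z}
    {z | z ∈ gS (p * m) ∧ star c ∣ z} ((gS_finite (p * m)).subset fun z h => h.1)
    ((gS_finite (p * m)).subset fun z h => h.1)
  rw [← hu, ← hi, hA, hB] at key
  omega

lemma gS_one_ndvd (p m : ℕ) (hp : p.Prime) (h1 : p % 4 = 1) (hm : ¬ p ∣ m) :
    (gS (p * m)).ncard = 2 * (gS m).ncard := by
  rw [← gS_one_aux p m hp h1]
  have : {z | z ∈ gS (p * m) ∧ (p : GaussianInt) ∣ z} = ∅ := by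
    rw [Set.eq_empty_iff_forall_notMem]
    rintro z ⟨hz, w, rfl⟩
    have h : ((p : GaussianInt) * w).norm = ((p * m : ℕ) : ℤ) := hz
    rw [Zsqrtd.norm_mul, gnorm_natCast] at h
    push_cast at h
    apply hm
    have h' : (p : ℤ) * w.norm = m :=
      mul_left_cancel₀ (a := (p : ℤ)) (by exact_mod_cast hp.ne_zero) (by linarith)
    exact_mod_cast Dvd.intro _ h'
  rw [this, Set.ncard_empty, add_zero]

lemma gS_one_mul (p k : ℕ) (hp : p.Prime) (h1 : p % 4 = 1) :
    (gS (p * (p * k))).ncard + (gS k).ncard = 2 * (gS (p * k)).ncard := by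
  rw [← gS_one_aux p (p * k) hp h1]
  have hpp : 0 < p * p := Nat.mul_pos hp.pos hp.pos
  rw [← gS_mul_ncard p (ne_zero_of_gnorm _ _ hpp (gnorm_natCast p)) k,
    gS_image _ _ k hpp (gnorm_natCast p), mul_assoc]

lemma gS_base : (gS 1).ncard = 4 := by
  have : gS 1 = (({⟨1, 0⟩, ⟨-1, 0⟩, ⟨0, 1⟩, ⟨0, -1⟩} : Finset GaussianInt) : Set GaussianInt) := by
    ext z
    have : z ∈ gS 1 ↔ z.re ^ 2 + z.im ^ 2 = 1 := by rw [← gnorm]; simp [gS]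
    rw [this]
    simp only [Finset.coe_insert, Finset.coe_singleton, Set.mem_insert_iff,
      Set.mem_singleton_iff, Zsqrtd.ext_iff]
    constructor
    · intro h
      have a1 : z.re ≤ 1 := by nlinarith [sq_nonneg z.im]
      have a2 : -1 ≤ z.re := by nlinarith [sq_nonneg z.im]
      have b1 : z.im ≤ 1 := by nlinarith [sq_nonneg z.re]
      have b2 : -1 ≤ z.im := by nlinarith [sq_nonneg z.re]
      generalize z.re = a at *
      generalize z.im = b at *
      interval_cases a <;> interval_cases b <;> simp_all
    · rintro (⟨h, h'⟩ | ⟨h, h'⟩ | ⟨h, h'⟩ | ⟨h, h'⟩) <;> rw [h, h'] <;> norm_num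
  rw [this, Set.ncard_coe_finset]
  decide

/-- the divisor sum of the character mod 4 -/
def chiSum (n : ℕ) : ℤ := ∑ d ∈ n.divisors, ZMod.χ₄ (d : ZMod 4)

lemma chiSum_eq (n : ℕ) : chiSum n = (dMod4 1 n : ℤ) - (dMod4 3 n : ℤ) := by
  unfold chiSum dMod4
  rw [Finset.card_filter, Finset.card_filter]
  push_cast
  rw [← Finset.sum_sub_distrib]
  refine Finset.sum_congr rfl fun d _ => ?_
  rw [ZMod.χ₄_nat_eq_if_mod_four]
  have := Nat.mod_lt d (show 4 > 0 by norm_num)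
  split_ifs <;> first | rfl | omega

lemma chi_image (p m : ℕ) (hp : p.Prime) :
    ∑ d ∈ m.divisors.image (fun d => p * d), ZMod.χ₄ (d : ZMod 4)
      = ZMod.χ₄ (p : ZMod 4) * chiSum m := by
  rw [Finset.sum_image (fun a _ b _ h => Nat.eq_of_mul_eq_mul_left hp.pos h), chiSum,
    Finset.mul_sum]
  refine Finset.sum_congr rfl fun d _ => ?_
  push_cast
  rw [map_mul]

lemma div_union (p m : ℕ) (hp : p.Prime) (hm : m ≠ 0) :
    (p * m).divisors = m.divisors ∪ m.divisors.image (fun d => p * d) := by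
  ext d
  simp only [Nat.mem_divisors, Finset.mem_union, Finset.mem_image]
  constructor
  · rintro ⟨h, _⟩
    by_cases hd : p ∣ d
    · obtain ⟨e, rfl⟩ := hd
      exact Or.inr ⟨e, ⟨Nat.dvd_of_mul_dvd_mul_left hp.pos h, hm⟩, rfl⟩
    · exact Or.inl ⟨((hp.coprime_iff_not_dvd.mpr hd).symm).dvd_of_dvd_mul_left h, hm⟩
  · rintro (⟨h, _⟩ | ⟨e, ⟨h, _⟩, rfl⟩)
    · exact ⟨h.mul_left p, mul_ne_zero hp.ne_zero hm⟩
    · exact ⟨mul_dvd_mul_left p h, mul_ne_zero hp.ne_zero hm⟩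

lemma chiSum_ndvd (p m : ℕ) (hp : p.Prime) (hm : m ≠ 0) (hd : ¬ p ∣ m) :
    chiSum (p * m) = (1 + ZMod.χ₄ (p : ZMod 4)) * chiSum m := by
  have hdis : Disjoint m.divisors (m.divisors.image (fun d => p * d)) := by
    rw [Finset.disjoint_left]
    intro d h h'
    obtain ⟨e, _, rfl⟩ := Finset.mem_image.mp h'
    exact hd ((dvd_mul_right p e).trans (Nat.dvd_of_mem_divisors h))
  rw [chiSum, div_union p m hp hm, Finset.sum_union hdis, chi_image p m hp, chiSum]
  ring

lemma chiSum_mul (p k : ℕ) (hp : p.Prime) (hk : k ≠ 0) :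
    chiSum (p * (p * k)) = (1 + ZMod.χ₄ (p : ZMod 4)) * chiSum (p * k)
      - ZMod.χ₄ (p : ZMod 4) * chiSum k := by
  have hpk : p * k ≠ 0 := mul_ne_zero hp.ne_zero hk
  have hi : (p * k).divisors ∩ (p * k).divisors.image (fun d => p * d)
      = k.divisors.image (fun d => p * d) := by
    ext d
    simp only [Nat.mem_divisors, Finset.mem_inter, Finset.mem_image]
    constructor
    · rintro ⟨⟨h, _⟩, e, _, rfl⟩
      exact ⟨e, ⟨Nat.dvd_of_mul_dvd_mul_left hp.pos h, hk⟩, rfl⟩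
    · rintro ⟨e, ⟨h, _⟩, rfl⟩
      exact ⟨⟨mul_dvd_mul_left p h, hpk⟩, e, ⟨h.mul_left p, hpk⟩, rfl⟩
  have key := Finset.sum_union_inter (s₁ := (p * k).divisors)
    (s₂ := (p * k).divisors.image (fun d => p * d)) (f := fun d : ℕ => ZMod.χ₄ (d : ZMod 4))
  rw [hi, ← div_union p (p * k) hp hpk, chi_image p _ hp, chi_image p _ hp] at key
  change chiSum (p * (p * k)) + _ = chiSum (p * k) + _ at key
  linarith

lemma gS_eq_chiSum (n : ℕ) (hn : n ≠ 0) : ((gS n).ncard : ℤ) = 4 * chiSum n := by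
  induction n using Nat.strong_induction_on with
  | _ n ih =>
    by_cases h1 : n = 1
    · subst h1
      rw [gS_base]
      simp [chiSum]
    obtain ⟨p, hp, m, rfl⟩ := Nat.exists_prime_and_dvd h1
    have hm : m ≠ 0 := right_ne_zero_of_mul hn
    have hlt : m < p * m := lt_mul_of_one_lt_left (Nat.pos_of_ne_zero hm) hp.one_lt
    have ihm := ih m hlt hm
    have hcase : p = 2 ∨ p % 4 = 1 ∨ p % 4 = 3 := by
      rcases hp.eq_two_or_odd with h | h <;> omega
    by_cases hd : p ∣ m
    · obtain ⟨k, rfl⟩ := hd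
      have hk : k ≠ 0 := right_ne_zero_of_mul hm
      have hlt' : k < p * k := lt_mul_of_one_lt_left (Nat.pos_of_ne_zero hk) hp.one_lt
      have ihk := ih k (hlt'.trans hlt) hk
      rw [chiSum_mul p k hp hk]
      rcases hcase with rfl | h | h
      · have : ZMod.χ₄ ((2 : ℕ) : ZMod 4) = 0 := by decide
        rw [this, gS_two, ihm]; ring
      · rw [ZMod.χ₄_nat_one_mod_four h]
        have := gS_one_mul p k hp h
        zify at this
        linarith
      · rw [ZMod.χ₄_nat_three_mod_four h, gS_three_mul p k hp h, ihk]; ring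
    · rw [chiSum_ndvd p m hp hm hd]
      rcases hcase with rfl | h | h
      · have : ZMod.χ₄ ((2 : ℕ) : ZMod 4) = 0 := by decide
        rw [this, gS_two, ihm]; ring
      · rw [ZMod.χ₄_nat_one_mod_four h, gS_one_ndvd p m hp h hd]
        push_cast
        linarith
      · rw [ZMod.χ₄_nat_three_mod_four h, gS_three_ndvd p m hp h hd]; simp

theorem r2_eq_four_mul_sub (n : ℕ) (hn : 1 ≤ n) :
    (r2 n : ℤ) = 4 * ((dMod4 1 n : ℤ) - (dMod4 3 n : ℤ)) := by
  rw [r2_eq_gS, gS_eq_chiSum n (by omega), chiSum_eq]
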